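/- arXiv:math/9906008 — 6 statements merged into one kernel-verified Lean document; each statement's English description precedes it below -/
import Mathlib

section
/- Let φ : F → F be an atoroidal automorphism of a finitely generated free group F. If there exist a positive integer M and a real number λ > 1 such that λ·‖g‖ ≤ max(‖φ^M(g)‖, ‖φ^{-M}(g)‖) for all g ∈ F, where ‖g‖ denotes the conjugacy length of g, then φ is hyperbolic; that is, there exist a positive integer M' and a real number λ' > 1 such that λ'·|g| ≤ max(|φ^{M'}(g)|, |φ^{-M'}(g)|) for all g ∈ F. -/
/-- The conjugacy length of `g`: the length of the shortest word in the
conjugacy class of `g`, i.e. the minimum of `|h * g * h⁻¹|` over all `h`. -/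
noncomputable def conjLength {n : ℕ} (g : FreeGroup (Fin n)) : ℕ :=
  sInf (Set.range fun h : FreeGroup (Fin n) => FreeGroup.norm (h * g * h⁻¹))

open FreeGroup in
theorem aux_cyc {n : ℕ} {L : List (Fin n × Bool)} (hL : IsCyclicallyReduced L)
    (h : FreeGroup (Fin n)) : L.length ≤ norm (h * mk L * h⁻¹) := by
  have hp : ∀ (x : FreeGroup (Fin n)) (k : ℕ), norm (x ^ k) ≤ k * norm x := by
    intro x k
    induction k with
    | zero => simp
    | succ k ih =>
      rw [pow_succ]
      have := norm_mul_le (x ^ k) x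
      linarith
  have h1 : ∀ k : ℕ, norm ((mk L) ^ k) = k * L.length := by
    intro k
    rw [FreeGroup.norm, pow_mk, toWord_mk, (hL.flatten_replicate k).isReduced.reduce_eq]
    simp
  by_contra! hlt
  have h2 : (mk L) ^ (2 * norm h + 1) = h⁻¹ * (h * mk L * h⁻¹) ^ (2 * norm h + 1) * h := by
    rw [conj_pow]; group
  have h3 := h1 (2 * norm h + 1)
  have h4 := hp (h * mk L * h⁻¹) (2 * norm h + 1)
  rw [h2] at h3
  have h5 := norm_mul_le (h⁻¹ * (h * mk L * h⁻¹) ^ (2 * norm h + 1)) h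
  have h6 := norm_mul_le h⁻¹ ((h * mk L * h⁻¹) ^ (2 * norm h + 1))
  rw [norm_inv_eq] at h6
  nlinarith

theorem aux_le_conjLength {n : ℕ} {g : FreeGroup (Fin n)} {m : ℕ}
    (h : ∀ k : FreeGroup (Fin n), m ≤ FreeGroup.norm (k * g * k⁻¹)) : m ≤ conjLength g := by
  apply le_csInf (Set.range_nonempty _)
  rintro _ ⟨k, rfl⟩
  exact h k

theorem aux_conjLength_le {n : ℕ} (g : FreeGroup (Fin n)) : conjLength g ≤ FreeGroup.norm g :=
  Nat.sInf_le ⟨1, by simp⟩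

theorem aux_comm {n : ℕ} (hs : ∀ a b : Fin n, a = b) (g h : FreeGroup (Fin n)) :
    h * g = g * h := by
  have key : ∀ (a : Fin n) (g : FreeGroup (Fin n)), Commute (FreeGroup.of a) g := by
    intro a g
    induction g using FreeGroup.induction_on with
    | C1 => exact Commute.one_right _
    | of x => rw [hs a x]
    | inv_of x ih => exact ih.inv_right
    | mul x y hx hy => exact hx.mul_right hy
  have : Commute h g := by
    induction h using FreeGroup.induction_on with
    | C1 => exact Commute.one_left _
    | of x => exact key x g
    | inv_of x ih => exact ih.inv_left
    | mul x y hx hy => exact hx.mul_left hy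
  exact this

open FreeGroup in
theorem aux_key {n : ℕ} (g : FreeGroup (Fin n)) :
    ∃ x : FreeGroup (Fin n), norm x ≤ 1 ∧ norm g ≤ conjLength (g * x) := by
  by_cases hs : ∀ a b : Fin n, a = b
  · refine ⟨1, by simp, aux_le_conjLength fun k => ?_⟩
    rw [mul_one, aux_comm hs g k, mul_inv_cancel_right]
  by_cases hc : IsCyclicallyReduced g.toWord
  · refine ⟨1, by simp, aux_le_conjLength fun k => ?_⟩
    have := aux_cyc hc k
    rw [mk_toWord] at this
    simpa [FreeGroup.norm] using this
  · have hr : IsReduced g.toWord := isReduced_toWord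
    rw [isCyclicallyReduced_iff] at hc
    push Not at hc
    obtain ⟨a, ha, b, hb, hab, hab2⟩ := hc hr
    have : ∃ c : Fin n, c ≠ a.1 := by
      by_contra! h
      exact hs fun x y => (h x).trans (h y).symm
    obtain ⟨c, hca⟩ := this
    refine ⟨of c, by simp, aux_le_conjLength fun k => ?_⟩
    have hL : IsCyclicallyReduced (g.toWord ++ [(c, true)]) := by
      refine ⟨?_, ?_⟩
      · unfold FreeGroup.IsReduced
        rw [List.isChain_append]
        refine ⟨hr, by simp, ?_⟩
        intro x hx y hy hxy
        have hx' : x = a := by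
          simp only [Option.mem_def] at hx ha
          rw [ha] at hx
          simpa using hx.symm
        have hy' : y = (c, true) := by simpa using hy.symm
        subst hx' hy'
        exact absurd hxy.symm hca
      · intro x hx y hy hxy
        have hy' : y = b := by
          simp only [Option.mem_def] at hb hy
          rw [List.head?_append, hb] at hy
          simpa using hy.symm
        have hx' : x = (c, true) := by simpa using hx.symm
        subst hy' hx'
        exact absurd (hxy.trans hab.symm) hca
    have := aux_cyc hL k
    rw [← mul_mk, mk_toWord] at this
    have h2 : norm g ≤ (g.toWord ++ [(c, true)]).length := by simp [FreeGroup.norm]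
    exact h2.trans this

theorem aux_finite {n : ℕ} (B : ℕ) : {g : FreeGroup (Fin n) | FreeGroup.norm g ≤ B}.Finite :=
  (List.finite_length_le (Fin n × Bool) B).preimage FreeGroup.toWord_injective.injOn

/-- Forward growth. -/
theorem aux_grow {n : ℕ} (ψ : MulAut (FreeGroup (Fin n))) (μ : ℝ) (hμ : 1 < μ) (B : ℕ)
    (h : ∀ g : FreeGroup (Fin n), B < FreeGroup.norm g →
      μ * (FreeGroup.norm g : ℝ) ≤
        max (FreeGroup.norm (ψ g) : ℝ) (FreeGroup.norm (ψ⁻¹ g) : ℝ))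
    (g : FreeGroup (Fin n)) (hg : B < FreeGroup.norm g)
    (h1 : μ * (FreeGroup.norm g : ℝ) ≤ FreeGroup.norm (ψ g)) (k : ℕ) :
    μ * (FreeGroup.norm g : ℝ) ≤ FreeGroup.norm ((ψ ^ (k + 1)) g) := by
  have key : FreeGroup.norm g ≤ FreeGroup.norm ((ψ ^ k) g) ∧
      μ * (FreeGroup.norm ((ψ ^ k) g) : ℝ) ≤ FreeGroup.norm ((ψ ^ (k + 1)) g) := by
    induction k with
    | zero => simpa using h1
    | succ k ih =>
      obtain ⟨ih1, ih2⟩ := ih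
      have hpos : (0 : ℝ) < FreeGroup.norm ((ψ ^ k) g) := by
        have : 0 < FreeGroup.norm ((ψ ^ k) g) := by omega
        exact_mod_cast this
      have hlt : (FreeGroup.norm ((ψ ^ k) g) : ℝ) < FreeGroup.norm ((ψ ^ (k + 1)) g) := by
        nlinarith
      have hlt' : FreeGroup.norm ((ψ ^ k) g) < FreeGroup.norm ((ψ ^ (k + 1)) g) := by
        exact_mod_cast hlt
      refine ⟨by omega, ?_⟩
      have h3 := h ((ψ ^ (k + 1)) g) (by omega)
      have e1 : ψ ((ψ ^ (k + 1)) g) = (ψ ^ (k + 1 + 1)) g := by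
        rw [pow_succ' ψ (k + 1)]; rfl
      have e2 : ψ⁻¹ ((ψ ^ (k + 1)) g) = (ψ ^ k) g := by
        rw [← MulAut.mul_apply, pow_succ', inv_mul_cancel_left]
      rw [e1, e2] at h3
      rcases le_max_iff.1 h3 with h4 | h4
      · exact h4
      · nlinarith
  have : (FreeGroup.norm g : ℝ) ≤ FreeGroup.norm ((ψ ^ k) g) := by exact_mod_cast key.1
  nlinarith [key.2]

theorem aux_main {n : ℕ} (ψ : MulAut (FreeGroup (Fin n)))
    (hat : ∀ g : FreeGroup (Fin n), g ≠ 1 → ∀ k : ℕ, 0 < k → (ψ ^ k) g ≠ g)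
    (lam : ℝ) (hlam : 1 < lam)
    (hc : ∀ g : FreeGroup (Fin n), lam * (conjLength g : ℝ) ≤
      max (conjLength (ψ g) : ℝ) (conjLength (ψ⁻¹ g) : ℝ)) :
    ∃ (K : ℕ) (μ : ℝ), 1 < μ ∧ ∀ g : FreeGroup (Fin n), μ * (FreeGroup.norm g : ℝ) ≤
      max (FreeGroup.norm ((ψ ^ (K + 1)) g) : ℝ) (FreeGroup.norm (((ψ⁻¹) ^ (K + 1)) g) : ℝ) := by
  obtain ⟨C1, hC1⟩ := ((aux_finite (n := n) 1).image fun x => FreeGroup.norm (ψ x)).bddAbove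
  obtain ⟨C2, hC2⟩ := ((aux_finite (n := n) 1).image fun x => FreeGroup.norm (ψ⁻¹ x)).bddAbove
  have hC1' : ∀ x : FreeGroup (Fin n), FreeGroup.norm x ≤ 1 → FreeGroup.norm (ψ x) ≤ C1 :=
    fun x hx => hC1 ⟨x, hx, rfl⟩
  have hC2' : ∀ x : FreeGroup (Fin n), FreeGroup.norm x ≤ 1 → FreeGroup.norm (ψ⁻¹ x) ≤ C2 :=
    fun x hx => hC2 ⟨x, hx, rfl⟩
  have step : ∀ g : FreeGroup (Fin n), lam * (FreeGroup.norm g : ℝ) ≤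
      max (FreeGroup.norm (ψ g) : ℝ) (FreeGroup.norm (ψ⁻¹ g) : ℝ) + (C1 + C2) := by
    intro g
    obtain ⟨x, hx, hgx⟩ := aux_key g
    have a1 : lam * (FreeGroup.norm g : ℝ) ≤ lam * (conjLength (g * x) : ℝ) := by
      gcongr
    have gen : ∀ (θ : MulAut (FreeGroup (Fin n))) (C : ℕ), FreeGroup.norm (θ x) ≤ C →
        (conjLength (θ (g * x)) : ℝ) ≤ FreeGroup.norm (θ g) + C := by
      intro θ C h
      have h1 := aux_conjLength_le (θ (g * x))
      rw [map_mul] at h1 ⊢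
      have h2 := FreeGroup.norm_mul_le (θ g) (θ x)
      have : conjLength (θ g * θ x) ≤ FreeGroup.norm (θ g) + C := by omega
      exact_mod_cast this
    have b1 := gen ψ C1 (hC1' x hx)
    have b2 := gen ψ⁻¹ C2 (hC2' x hx)
    have p1 : (0 : ℝ) ≤ C1 := Nat.cast_nonneg _
    have p2 : (0 : ℝ) ≤ C2 := Nat.cast_nonneg _
    have m1 := le_max_left (FreeGroup.norm (ψ g) : ℝ) (FreeGroup.norm (ψ⁻¹ g) : ℝ)
    have m2 := le_max_right (FreeGroup.norm (ψ g) : ℝ) (FreeGroup.norm (ψ⁻¹ g) : ℝ)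
    rcases le_max_iff.1 (hc (g * x)) with h | h <;> linarith
  obtain ⟨μ, hμ1, hμ2⟩ := exists_between hlam
  obtain ⟨B, hB⟩ := exists_nat_gt (((C1 : ℝ) + C2) / (lam - μ))
  have hB' : (C1 : ℝ) + C2 < B * (lam - μ) := by
    rwa [div_lt_iff₀ (by linarith)] at hB
  have big : ∀ g : FreeGroup (Fin n), B < FreeGroup.norm g →
      μ * (FreeGroup.norm g : ℝ) ≤
        max (FreeGroup.norm (ψ g) : ℝ) (FreeGroup.norm (ψ⁻¹ g) : ℝ) := by
    intro g hg
    have h1 := step g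
    have h2 : (B : ℝ) < FreeGroup.norm g := by exact_mod_cast hg
    nlinarith
  obtain ⟨D, hD⟩ := exists_nat_gt (μ * B)
  have ev : ∀ᶠ k : ℕ in Filter.atTop, ∀ g ∈ {g : FreeGroup (Fin n) | FreeGroup.norm g ≤ B},
      g ≠ 1 → D < FreeGroup.norm ((ψ ^ k) g) := by
    rw [Filter.eventually_all_finite (aux_finite B)]
    intro g _
    by_cases hg : g = 1
    · simp [hg]
    have inj : Function.Injective fun k : ℕ => (ψ ^ k) g := by
      have : ∀ i j : ℕ, i < j → (ψ ^ i) g ≠ (ψ ^ j) g := by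
        intro i j hij he
        obtain ⟨d, rfl⟩ := Nat.exists_eq_add_of_lt hij
        rw [add_assoc, pow_add, MulAut.mul_apply] at he
        exact hat g hg (d + 1) (by omega) ((ψ ^ i).injective he).symm
      intro i j hij
      rcases lt_trichotomy i j with h | h | h
      · exact absurd hij (this i j h)
      · exact h
      · exact absurd hij.symm (this j i h)
    have fin := (aux_finite (n := n) D).preimage inj.injOn
    rw [← Nat.cofinite_eq_atTop]
    filter_upwards [fin.compl_mem_cofinite] with k hk _
    simpa using hk
  obtain ⟨K, hK⟩ := Filter.eventually_atTop.1 ev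
  refine ⟨K, μ, hμ1, fun g => ?_⟩
  by_cases hg : FreeGroup.norm g ≤ B
  · by_cases hg1 : g = 1
    · simp [hg1]
    · have h1 := hK (K + 1) (by omega) g hg hg1
      have h2 : (D : ℝ) < FreeGroup.norm ((ψ ^ (K + 1)) g) := by exact_mod_cast h1
      have h3 : (FreeGroup.norm g : ℝ) ≤ B := by exact_mod_cast hg
      apply le_max_of_le_left
      nlinarith
  · rw [not_le] at hg
    rcases le_max_iff.1 (big g hg) with h | h
    · exact le_max_of_le_left (aux_grow ψ μ hμ1 B big g hg h K)
    · refine le_max_of_le_right (aux_grow ψ⁻¹ μ hμ1 B (fun g hg => ?_) g hg h K)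
      rw [inv_inv, max_comm]
      exact big g hg



/-- If an atoroidal automorphism of a finitely generated free group satisfies the
hyperbolicity inequality with respect to conjugacy lengths, then it is hyperbolic
(with respect to word lengths). -/
theorem hyperbolic_of_conj_hyperbolic (n : ℕ) (φ : MulAut (FreeGroup (Fin n)))
    (hat : ∀ g : FreeGroup (Fin n), g ≠ 1 → ∀ k : ℕ, 0 < k → ¬ IsConj ((φ ^ k) g) g)
    (hconj : ∃ (M : ℕ) (lam : ℝ), 0 < M ∧ 1 < lam ∧
      ∀ g : FreeGroup (Fin n),
        lam * (conjLength g : ℝ) ≤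
          max (conjLength ((φ ^ (M : ℤ)) g) : ℝ)
              (conjLength ((φ ^ (-(M : ℤ))) g) : ℝ)) :
    ∃ (M' : ℕ) (lam' : ℝ), 0 < M' ∧ 1 < lam' ∧
      ∀ g : FreeGroup (Fin n),
        lam' * (FreeGroup.norm g : ℝ) ≤
          max (FreeGroup.norm ((φ ^ (M' : ℤ)) g) : ℝ)
              (FreeGroup.norm ((φ ^ (-(M' : ℤ))) g) : ℝ) := by
  obtain ⟨M, lam, hM, hlam, hc⟩ := hconj
  obtain ⟨K, μ, hμ, hK⟩ := aux_main (φ ^ M) (fun g hg k hk h => by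
    apply hat g hg (M * k) (Nat.mul_pos hM hk)
    rw [pow_mul, h]) lam hlam (fun g => by
      have := hc g
      rwa [zpow_neg, zpow_natCast] at this)
  refine ⟨M * (K + 1), μ, by positivity, hμ, fun g => ?_⟩
  have := hK g
  rwa [inv_pow, ← pow_mul, ← zpow_natCast, ← zpow_neg] at this
end

section
/- Hyperbolicity of an automorphism of a finitely generated free group depends only on its outer class: if φ : F → F is a hyperbolic automorphism of a finitely generated free group F, h ∈ F, and ψ : F → F is the automorphism defined by ψ(g) = h·φ(g)·h⁻¹ for all g ∈ F, then ψ is hyperbolic. -/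
open FreeGroup in
lemma aux_growth {n : ℕ} (S : MulAut (FreeGroup (Fin n))) (L : ℕ) (hL : 1 ≤ L) (mu : ℝ) (hmu : 1 < mu)
    (H : ∀ g : FreeGroup (Fin n), L ≤ norm g → mu * (norm g : ℝ) ≤ max (norm (S g) : ℝ) (norm (S⁻¹ g) : ℝ))
    (g : FreeGroup (Fin n)) (hg : L ≤ norm g) (h1 : mu * (norm g : ℝ) ≤ norm (S g)) (k : ℕ) :
    mu ^ k * (norm g : ℝ) ≤ norm ((S ^ k) g) := by
  have key : ∀ k : ℕ, L ≤ norm ((S ^ k) g) ∧ mu ^ k * (norm g : ℝ) ≤ norm ((S ^ k) g) ∧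
      mu * (norm ((S ^ k) g) : ℝ) ≤ norm (S ((S ^ k) g)) := by
    intro k
    induction k with
    | zero => simpa using ⟨hg, h1⟩
    | succ k ih =>
      obtain ⟨a, b, c⟩ := ih
      have e : (S ^ (k+1)) g = S ((S ^ k) g) := by rw [pow_succ']; rfl
      rw [e]
      set x := (S ^ k) g
      have ha : (1 : ℝ) ≤ norm x := by exact_mod_cast hL.trans a
      have hlt : (norm x : ℝ) < norm (S x) := by nlinarith
      have hSx : L ≤ norm (S x) := a.trans (by exact_mod_cast hlt.le)
      refine ⟨hSx, ?_, ?_⟩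
      · calc mu ^ (k+1) * (norm g : ℝ) = mu * (mu ^ k * norm g) := by ring
          _ ≤ mu * norm x := by gcongr
          _ ≤ _ := c
      · have := H _ hSx
        rw [MulAut.inv_apply_self] at this
        rcases le_max_iff.1 this with h | h
        · exact h
        · nlinarith
  exact (key k).2.1

open FreeGroup in
lemma aux_finite_s4 (n L : ℕ) : {g : FreeGroup (Fin n) | norm g < L}.Finite := by
  have := (List.finite_length_lt (Fin n × Bool) L).preimage
    (f := (toWord : FreeGroup (Fin n) → _)) toWord_injective.injOn
  exact this

open FreeGroup in
lemma aux_long {n : ℕ} (g : FreeGroup (Fin n)) (hg : g ≠ 1) (L : ℕ) : ∃ m : ℕ, L ≤ norm (g ^ m) := by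
  by_contra! hc
  have hinj : Function.Injective (fun m : ℕ => g ^ m) :=
    injective_pow_iff_not_isOfFinOrder.2 (not_isOfFinOrder_of_isMulTorsionFree hg)
  exact Set.infinite_range_of_injective hinj ((aux_finite_s4 n L).subset (by rintro _ ⟨m, rfl⟩; exact hc m))

open FreeGroup in
lemma aux_escape {n : ℕ} (T : MulAut (FreeGroup (Fin n))) (L : ℕ) (hL : 1 ≤ L) (mu : ℝ) (hmu : 1 < mu)
    (H : ∀ g : FreeGroup (Fin n), L ≤ norm g → mu * (norm g : ℝ) ≤ max (norm (T g) : ℝ) (norm (T⁻¹ g) : ℝ))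
    (g : FreeGroup (Fin n)) (hg : g ≠ 1) : ∃ j : ℤ, L ≤ norm ((T ^ j) g) := by
  by_contra! hc
  have hni : ¬ Function.Injective (fun j : ℤ => (T ^ j) g) := fun hinj =>
    Set.infinite_range_of_injective hinj ((aux_finite_s4 n L).subset (by rintro _ ⟨m, rfl⟩; exact hc m))
  have hp : ∃ p : ℕ, 0 < p ∧ (T ^ p) g = g := by
    have : ∀ a b : ℤ, a < b → (T ^ a) g = (T ^ b) g → ∃ p : ℕ, 0 < p ∧ (T ^ p) g = g := by
      intro a b hab e
      refine ⟨(b - a).toNat, by omega, ?_⟩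
      rw [← zpow_natCast, Int.toNat_of_nonneg (by omega), sub_eq_neg_add, zpow_add, MulAut.mul_apply, ← e,
        ← MulAut.mul_apply, ← zpow_add]
      simp
    simp only [Function.Injective, not_forall] at hni
    obtain ⟨a, b, e, hab⟩ := hni
    rcases lt_or_gt_of_ne hab with h | h
    · exact this a b h e
    · exact this b a h e.symm
  obtain ⟨p, hp, e⟩ := hp
  obtain ⟨m, hm⟩ := aux_long g hg L
  have e1 : (T ^ p) (g ^ m) = g ^ m := by rw [map_pow, e]
  have e2 : (T⁻¹ ^ p) (g ^ m) = g ^ m := by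
    rw [inv_pow]; conv_lhs => rw [← e1]
    exact MulAut.inv_apply_self ..
  have h1 : 1 < mu ^ p := one_lt_pow₀ hmu hp.ne'
  have h0 : (1 : ℝ) ≤ norm (g ^ m) := by exact_mod_cast hL.trans hm
  rcases le_max_iff.1 (H _ hm) with h | h
  · have := aux_growth T L hL mu hmu H _ hm h p
    rw [e1] at this; nlinarith
  · have := aux_growth T⁻¹ L hL mu hmu (by intro g hg; rw [inv_inv, max_comm]; exact H g hg) _ hm h p
    rw [e2] at this; nlinarith

open FreeGroup in
lemma aux_each {n : ℕ} (T : MulAut (FreeGroup (Fin n))) (L : ℕ) (hL : 1 ≤ L) (mu : ℝ) (hmu : 1 < mu)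
    (H : ∀ g : FreeGroup (Fin n), L ≤ norm g → mu * (norm g : ℝ) ≤ max (norm (T g) : ℝ) (norm (T⁻¹ g) : ℝ))
    (g : FreeGroup (Fin n)) : ∀ᶠ k : ℕ in Filter.atTop,
      2 * (norm g : ℝ) ≤ max (norm ((T ^ k) g) : ℝ) (norm ((T⁻¹ ^ k) g) : ℝ) := by
  by_cases hg : g = 1
  · subst hg; simp
  obtain ⟨j, hj⟩ := aux_escape T L hL mu hmu H g hg
  set y := (T ^ j) g with hy
  have h0 : (1 : ℝ) ≤ norm y := by exact_mod_cast hL.trans hj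
  obtain ⟨K, hK⟩ := Filter.eventually_atTop.1
    ((tendsto_pow_atTop_atTop_of_one_lt hmu).eventually_ge_atTop (2 * (norm g : ℝ)))
  have hK' : ∀ k ≥ K, 2 * (norm g : ℝ) ≤ mu ^ k * norm y := fun k hk => by
    have := hK k hk
    nlinarith [pow_pos (zero_lt_one.trans hmu) k]
  filter_upwards [Filter.eventually_ge_atTop (K + j.natAbs)] with k hk
  rcases le_max_iff.1 (H _ hj) with h | h
  · apply le_max_of_le_left
    have e : (T ^ k) g = (T ^ (k - j).toNat) y := by
      rw [hy, ← zpow_natCast T (k - j).toNat, ← MulAut.mul_apply, ← zpow_add, ← zpow_natCast]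
      congr 2; omega
    rw [e]
    exact (hK' _ (by omega)).trans (aux_growth T L hL mu hmu H _ hj h _)
  · apply le_max_of_le_right
    have e : (T⁻¹ ^ k) g = (T⁻¹ ^ (k + j).toNat) y := by
      rw [hy, ← zpow_natCast T⁻¹ (k + j).toNat, inv_zpow', ← MulAut.mul_apply, ← zpow_add, ← zpow_natCast, inv_zpow']
      congr 2; omega
    rw [e]
    exact (hK' _ (by omega)).trans
      (aux_growth T⁻¹ L hL mu hmu (by intro g hg; rw [inv_inv, max_comm]; exact H g hg) _ hj h _)

open FreeGroup in
lemma aux_all {n : ℕ} (T : MulAut (FreeGroup (Fin n))) (L : ℕ) (hL : 1 ≤ L) (mu : ℝ) (hmu : 1 < mu)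
    (H : ∀ g : FreeGroup (Fin n), L ≤ norm g → mu * (norm g : ℝ) ≤ max (norm (T g) : ℝ) (norm (T⁻¹ g) : ℝ)) :
    ∃ k : ℕ, 0 < k ∧ ∀ g : FreeGroup (Fin n),
      2 * (norm g : ℝ) ≤ max (norm ((T ^ k) g) : ℝ) (norm ((T⁻¹ ^ k) g) : ℝ) := by
  have h1 := (Filter.eventually_all_finite (aux_finite_s4 n L)).2
    (fun g _ => aux_each T L hL mu hmu H g)
  have h2 := (tendsto_pow_atTop_atTop_of_one_lt hmu).eventually_ge_atTop 2
  obtain ⟨k, h1, h2, hk⟩ := (h1.and (h2.and (Filter.eventually_gt_atTop 0))).exists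
  refine ⟨k, hk, fun g => ?_⟩
  by_cases hg : norm g < L
  · exact h1 g hg
  push Not at hg
  have hle : 2 * (norm g : ℝ) ≤ mu ^ k * norm g := by gcongr
  rcases le_max_iff.1 (H _ hg) with h | h
  · exact le_max_of_le_left (hle.trans (aux_growth T L hL mu hmu H _ hg h _))
  · exact le_max_of_le_right (hle.trans
      (aux_growth T⁻¹ L hL mu hmu (by intro g hg; rw [inv_inv, max_comm]; exact H g hg) _ hg h _))

open FreeGroup in
lemma aux_conj {n : ℕ} (a b c : FreeGroup (Fin n)) (h : a = c * b * c⁻¹) :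
    (norm b : ℝ) ≤ norm a + 2 * norm c := by
  have e : b = c⁻¹ * a * c := by rw [h]; group
  have h1 := norm_mul_le (c⁻¹ * a) c
  have h2 := norm_mul_le c⁻¹ a
  rw [norm_inv_eq] at h2
  rw [← e] at h1
  have : norm b ≤ norm a + 2 * norm c := by omega
  exact_mod_cast this


/-- Hyperbolicity of an automorphism of a finitely generated free group depends only
on its outer class: composing with an inner automorphism preserves hyperbolicity. -/
theorem hyperbolic_of_outer_equiv (n : ℕ) (φ ψ : MulAut (FreeGroup (Fin n)))
    (h : FreeGroup (Fin n)) (hψ : ∀ g : FreeGroup (Fin n), ψ g = h * φ g * h⁻¹)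
    (hhyp : ∃ (M : ℕ) (lam : ℝ), 0 < M ∧ 1 < lam ∧
      ∀ g : FreeGroup (Fin n),
        lam * (FreeGroup.norm g : ℝ) ≤
          max (FreeGroup.norm ((φ ^ (M : ℤ)) g) : ℝ)
              (FreeGroup.norm ((φ ^ (-(M : ℤ))) g) : ℝ)) :
    ∃ (M : ℕ) (lam : ℝ), 0 < M ∧ 1 < lam ∧
      ∀ g : FreeGroup (Fin n),
        lam * (FreeGroup.norm g : ℝ) ≤
          max (FreeGroup.norm ((ψ ^ (M : ℤ)) g) : ℝ)
              (FreeGroup.norm ((ψ ^ (-(M : ℤ))) g) : ℝ) := by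
  obtain ⟨M, lam, hM, hlam, hyp⟩ := hhyp
  have hc : ∀ k : ℕ, ∃ c, ∀ g, (ψ ^ k) g = c * (φ ^ k) g * c⁻¹ := by
    intro k
    induction k with
    | zero => exact ⟨1, by simp⟩
    | succ k ih =>
      obtain ⟨c, hc⟩ := ih
      refine ⟨h * φ c, fun g => ?_⟩
      rw [pow_succ', pow_succ', MulAut.mul_apply, MulAut.mul_apply, hc, hψ]
      simp [mul_assoc]
  obtain ⟨c, hc⟩ := hc M
  have hd : ∀ g, (ψ ^ M)⁻¹ g = (φ ^ M)⁻¹ c⁻¹ * (φ ^ M)⁻¹ g * ((φ ^ M)⁻¹ c⁻¹)⁻¹ := by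
    intro g
    apply (ψ ^ M).injective
    rw [hc ((φ ^ M)⁻¹ c⁻¹ * (φ ^ M)⁻¹ g * ((φ ^ M)⁻¹ c⁻¹)⁻¹)]
    simp only [map_mul, map_inv, MulAut.apply_inv_self]
    group
  generalize (φ ^ M)⁻¹ c⁻¹ = d at hd
  obtain ⟨L, hL⟩ := exists_nat_ge
    (2 * (2 * (FreeGroup.norm c : ℝ) + 2 * FreeGroup.norm d) / (lam - 1))
  have hl : 0 < lam - 1 := by linarith
  rw [div_le_iff₀ hl] at hL
  obtain ⟨k, hk, hfin⟩ := aux_all (ψ ^ M) (L + 1) (by omega) ((1 + lam) / 2) (by linarith) (by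
    intro g hg
    have h1 := hyp g
    have h2 := aux_conj _ _ _ (hc g)
    have h3 := aux_conj _ _ _ (hd g)
    rw [zpow_neg, zpow_natCast] at h1
    have h4 : (L : ℝ) ≤ FreeGroup.norm g := by exact_mod_cast (by omega : L ≤ FreeGroup.norm g)
    have h5 : (L : ℝ) * (lam - 1) ≤ FreeGroup.norm g * (lam - 1) := by gcongr
    have c0 : (0 : ℝ) ≤ FreeGroup.norm c := Nat.cast_nonneg _
    have d0 : (0 : ℝ) ≤ FreeGroup.norm d := Nat.cast_nonneg _
    rcases le_max_iff.1 h1 with h | h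
    · apply le_max_of_le_left; linarith
    · apply le_max_of_le_right; linarith)
  refine ⟨M * k, 2, Nat.mul_pos hM hk, by norm_num, fun g => ?_⟩
  have := hfin g
  rw [inv_pow, ← pow_mul] at this
  rw [zpow_neg, zpow_natCast]
  exact this
end

section
/- If φ : F → F is an atoroidal automorphism of a finitely generated free group F, then the mapping torus F ⋊_φ ℤ (the semidirect product in which the generator 1 ∈ ℤ acts on F by φ, so that n ∈ ℤ acts by φ^n) contains no subgroup isomorphic to ℤ × ℤ. -/
theorem isCyclic_of_comm_subgroup_free {α : Type} (K : Subgroup (FreeGroup α))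
    (hK : ∀ x y : K, x * y = y * x) : ∃ g : K, ∀ x : K, ∃ k : ℤ, x = g ^ k := by
  classical
  haveI : IsFreeGroup K := inferInstance
  let e := IsFreeGroup.toFreeGroup K
  have hsub : ∀ a b : IsFreeGroup.Generators K, a = b := by
    intro a b
    by_contra hab
    have h1 : FreeGroup.of a * FreeGroup.of b = FreeGroup.of b * FreeGroup.of a := by
      have := hK (e.symm (FreeGroup.of a)) (e.symm (FreeGroup.of b))
      rw [← map_mul, ← map_mul] at this
      exact e.symm.injective this
    have h2 := congrArg (FreeGroup.lift (fun c => if c = a then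
      (Equiv.swap 0 1 : Equiv.Perm (Fin 3)) else Equiv.swap 1 2)) h1
    simp only [map_mul, FreeGroup.lift_apply_of, if_true, if_neg (Ne.symm hab)] at h2
    revert h2
    decide
  by_cases hne : Nonempty (IsFreeGroup.Generators K)
  · obtain ⟨a⟩ := hne
    refine ⟨e.symm (FreeGroup.of a), fun x => ?_⟩
    have key : ∀ z : FreeGroup (IsFreeGroup.Generators K), ∃ k : ℤ, z = FreeGroup.of a ^ k := by
      intro z
      induction z using FreeGroup.induction_on with
      | C1 => exact ⟨0, by simp⟩
      | of b => exact ⟨1, by rw [hsub b a]; simp⟩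
      | inv_of b _ => exact ⟨-1, by rw [hsub b a]; simp⟩
      | mul x y hx hy =>
        obtain ⟨i, rfl⟩ := hx
        obtain ⟨j, rfl⟩ := hy
        exact ⟨i + j, (zpow_add _ _ _).symm⟩
    obtain ⟨k, hk⟩ := key (e x)
    exact ⟨k, by rw [← map_zpow, ← hk]; simp⟩
  · refine ⟨1, fun x => ⟨0, ?_⟩⟩
    haveI : IsEmpty (IsFreeGroup.Generators K) := not_nonempty_iff.mp hne
    exact e.injective (Subsingleton.elim _ _)

theorem no_inj_Z2_free {α : Type} (f : Multiplicative (ℤ × ℤ) →* FreeGroup α)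
    (hf : Function.Injective f) : False := by
  obtain ⟨⟨_, t, rfl⟩, ht⟩ := isCyclic_of_comm_subgroup_free f.range (by
    rintro ⟨_, x, rfl⟩ ⟨_, y, rfl⟩
    ext1
    change f x * f y = f y * f x
    rw [← map_mul, mul_comm, map_mul])
  have hx : ∀ x, ∃ k : ℤ, x = t ^ k := by
    intro x
    obtain ⟨k, hk⟩ := ht ⟨f x, x, rfl⟩
    have h2 := congrArg Subtype.val hk
    refine ⟨k, hf ?_⟩
    rw [map_zpow]
    exact h2
  obtain ⟨k, hk⟩ := hx (Multiplicative.ofAdd (1, 0))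
  obtain ⟨l, hl⟩ := hx (Multiplicative.ofAdd (0, 1))
  have hk' := congrArg Multiplicative.toAdd hk
  have hl' := congrArg Multiplicative.toAdd hl
  rw [toAdd_ofAdd, toAdd_zpow, Prod.ext_iff] at hk' hl'
  simp only [Prod.smul_fst, Prod.smul_snd, smul_eq_mul] at hk' hl'
  obtain ⟨a1, a2⟩ := hk'
  obtain ⟨b1, b2⟩ := hl'
  have hv : t.toAdd.2 = 0 := by
    rcases mul_eq_zero.mp a2.symm with h | h
    · rw [h] at a1; simp at a1
    · exact h
  rw [hv] at b2
  simp at b2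

theorem no_commuting_pair (n : ℕ) (φ : MulAut (FreeGroup (Fin n)))
    (hat : ∀ g : FreeGroup (Fin n), g ≠ 1 → ∀ k : ℕ, 0 < k → ¬ IsConj ((φ ^ k) g) g)
    (c d : SemidirectProduct (FreeGroup (Fin n)) (Multiplicative ℤ)
        (zpowersHom (MulAut (FreeGroup (Fin n))) φ))
    (hcd : d * c = c * d) (hc : c.right = 1) (hc1 : c ≠ 1) : d.right = 1 := by
  have hg : c.left ≠ 1 := fun h => hc1 (SemidirectProduct.ext h hc)
  have main : ∀ d : SemidirectProduct (FreeGroup (Fin n)) (Multiplicative ℤ)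
        (zpowersHom (MulAut (FreeGroup (Fin n))) φ), d * c = c * d →
        ¬ 0 < d.right.toAdd := by
    intro d hcd hpos
    obtain ⟨k, hk⟩ := Int.eq_ofNat_of_zero_le hpos.le
    have h := congrArg SemidirectProduct.left hcd
    rw [SemidirectProduct.mul_left, SemidirectProduct.mul_left, hc, map_one,
      zpowersHom_apply, hk, zpow_natCast, MulAut.one_apply] at h
    refine hat c.left hg k (by omega) (isConj_iff.mpr ⟨d.left, ?_⟩)
    rw [h, mul_inv_cancel_right]
  have h1 := main d hcd
  have h2 := main d⁻¹ (by
    have : Commute d c := hcd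
    exact this.inv_left)
  rw [SemidirectProduct.inv_right, toAdd_inv] at h2
  apply Multiplicative.toAdd.injective
  rw [toAdd_one]
  omega

/-- The mapping torus of an atoroidal automorphism of a finitely generated free group
contains no subgroup isomorphic to ℤ × ℤ. -/
theorem mapping_torus_no_Z2 (n : ℕ) (φ : MulAut (FreeGroup (Fin n)))
    (hat : ∀ g : FreeGroup (Fin n), g ≠ 1 → ∀ k : ℕ, 0 < k → ¬ IsConj ((φ ^ k) g) g) :
    ¬ ∃ H : Subgroup (SemidirectProduct (FreeGroup (Fin n)) (Multiplicative ℤ)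
        (zpowersHom (MulAut (FreeGroup (Fin n))) φ)),
      Nonempty (H ≃* Multiplicative (ℤ × ℤ)) := by
  rintro ⟨H, ⟨e⟩⟩
  let F := H.subtype.comp e.symm.toMonoidHom
  have hF : Function.Injective F := Subtype.val_injective.comp e.symm.injective
  let R := (SemidirectProduct.rightHom
    (φ := zpowersHom (MulAut (FreeGroup (Fin n))) φ)).comp F
  have hR : ∀ x, R x = (F x).right := fun _ => rfl
  -- a nontrivial element in the kernel of the projection to ℤ
  have hker : ∃ z, z ≠ 1 ∧ R z = 1 := by
    let A := Multiplicative.ofAdd ((1, 0) : ℤ × ℤ)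
    let B := Multiplicative.ofAdd ((0, 1) : ℤ × ℤ)
    by_cases hA : R A = 1
    · exact ⟨A, by simp [A, Prod.ext_iff], hA⟩
    · refine ⟨A ^ (R B).toAdd * B ^ (-(R A).toAdd), ?_, ?_⟩
      · intro h
        have h2 := congrArg (fun z => (Multiplicative.toAdd z).2) h
        simp [A, B] at h2
        exact hA h2
      · apply Multiplicative.toAdd.injective
        rw [map_mul, map_zpow, map_zpow, toAdd_mul, toAdd_zpow, toAdd_zpow, toAdd_one,
          smul_eq_mul, smul_eq_mul]
        ring
  obtain ⟨z, hz1, hz⟩ := hker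
  have hall : ∀ x, (F x).right = 1 := fun x =>
    no_commuting_pair n φ hat (F z) (F x) (by rw [← map_mul, mul_comm, map_mul]) hz
      (fun h => hz1 (hF (h.trans (map_one F).symm)))
  refine no_inj_Z2_free (α := Fin n) (MonoidHom.mk' (fun x => (F x).left) ?_) ?_
  · intro x y
    rw [map_mul, SemidirectProduct.mul_left, hall x, map_one, MulAut.one_apply]
  · intro x y hxy
    exact hF (SemidirectProduct.ext hxy ((hall x).trans (hall y).symm))
end

section
/- Let φ : F → F be an automorphism of a finitely generated free group F, and suppose there exist a positive integer M and a real number λ > 1 such that λ·|g| ≤ max(|φ^M(g)|, |φ^{-M}(g)|) for all g ∈ F. Then for every positive integer n and every g ∈ F, one has λ^n·|g| ≤ max(|φ^{nM}(g)|, |φ^{-nM}(g)|). -/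
/-- A nonnegative sequence satisfying the hyperbolicity inequality that starts growing
keeps growing geometrically. -/
theorem seq_growth_aux (lam : ℝ) (hlam : 1 < lam) (b : ℕ → ℝ) (hb : ∀ k, 0 ≤ b k)
    (h : ∀ k, lam * b (k + 1) ≤ max (b (k + 2)) (b k)) (h0 : lam * b 0 ≤ b 1) (m : ℕ) :
    lam ^ m * b 0 ≤ b m := by
  have step : ∀ k, lam * b k ≤ b (k + 1) := by
    intro k
    induction k with
    | zero => exact h0
    | succ k ih =>
      rcases le_max_iff.1 (h k) with h1 | h1
      · exact h1
      · have e1 : b (k + 1) = 0 := by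
          nlinarith [hb k, hb (k + 1), hb (k + 2)]
        rw [e1]
        simpa using hb (k + 2)
  induction m with
  | zero => simp
  | succ m ih =>
    calc lam ^ (m + 1) * b 0 = lam * (lam ^ m * b 0) := by ring
      _ ≤ lam * b m := by gcongr
      _ ≤ b (m + 1) := step m

/-- Iterating the hyperbolicity inequality: if `λ·|g| ≤ max(|φ^M g|, |φ^{-M} g|)`
for all `g`, then `λ^n·|g| ≤ max(|φ^{nM} g|, |φ^{-nM} g|)` for all `n ≥ 1` and `g`. -/
theorem hyperbolic_iterate (n : ℕ) (φ : MulAut (FreeGroup (Fin n)))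
    (M : ℕ) (hM : 0 < M) (lam : ℝ) (hlam : 1 < lam)
    (h : ∀ g : FreeGroup (Fin n),
      lam * (FreeGroup.norm g : ℝ) ≤
        max (FreeGroup.norm ((φ ^ (M : ℤ)) g) : ℝ)
            (FreeGroup.norm ((φ ^ (-(M : ℤ))) g) : ℝ)) :
    ∀ (m : ℕ), 0 < m → ∀ g : FreeGroup (Fin n),
      lam ^ m * (FreeGroup.norm g : ℝ) ≤
        max (FreeGroup.norm ((φ ^ ((m * M : ℕ) : ℤ)) g) : ℝ)
            (FreeGroup.norm ((φ ^ (-((m * M : ℕ) : ℤ))) g) : ℝ) := by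
  intro m _ g
  let a : ℤ → ℝ := fun k => (FreeGroup.norm ((φ ^ (k * (M : ℤ))) g) : ℝ)
  have ha : ∀ k, 0 ≤ a k := fun k => Nat.cast_nonneg _
  have hs : ∀ k, lam * a k ≤ max (a (k + 1)) (a (k - 1)) := by
    intro k
    have hk := h ((φ ^ (k * (M : ℤ))) g)
    rw [← MulAut.mul_apply, ← MulAut.mul_apply, ← zpow_add, ← zpow_add] at hk
    have e1 : (M : ℤ) + k * M = (k + 1) * M := by ring
    have e2 : -(M : ℤ) + k * M = (k - 1) * M := by ring
    rw [e1, e2] at hk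
    exact hk
  have ea : a 0 = (FreeGroup.norm g : ℝ) := by simp [a]
  have e1 : (FreeGroup.norm ((φ ^ ((m * M : ℕ) : ℤ)) g) : ℝ) = a m := by
    simp only [a, Nat.cast_mul]
  have e2 : (FreeGroup.norm ((φ ^ (-((m * M : ℕ) : ℤ))) g) : ℝ) = a (-m) := by
    simp only [a, Nat.cast_mul, neg_mul]
  rw [e1, e2, ← ea]
  rcases le_max_iff.1 (hs 0) with h1 | h1
  · refine le_max_of_le_left ?_
    refine seq_growth_aux lam hlam (fun k => a k) (fun k => ha _) (fun k => ?_) (by simpa using h1) m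
    have := hs ((k : ℤ) + 1)
    convert this using 3 <;> grind
  · refine le_max_of_le_right ?_
    have := seq_growth_aux lam hlam (fun k => a (-(k : ℤ))) (fun k => ha _) (fun k => ?_)
      (by simpa using h1) m
    · simpa using this
    have := hs (-(k : ℤ) - 1)
    rw [max_comm] at this
    convert this using 3 <;> grind
end

section
/- If φ : F → F is an atoroidal automorphism of a finitely generated free group F, then for every nontrivial g ∈ F the conjugacy lengths ‖φ^n(g)‖ tend to infinity as n → ∞. -/
/-- If `φ` is an atoroidal automorphism of a finitely generated free group, then for
every nontrivial `g` the conjugacy lengths `‖φ^n(g)‖` tend to infinity as `n → ∞`. -/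
theorem conjLength_tendsto_atTop (n : ℕ) (φ : MulAut (FreeGroup (Fin n)))
    (hat : ∀ g : FreeGroup (Fin n), g ≠ 1 → ∀ k : ℕ, 0 < k → ¬ IsConj ((φ ^ k) g) g)
    (g : FreeGroup (Fin n)) (hg : g ≠ 1) :
    Filter.Tendsto (fun m : ℕ => conjLength ((φ ^ m) g)) Filter.atTop Filter.atTop := by
  have hex : ∀ m : ℕ, ∃ h : FreeGroup (Fin n),
      FreeGroup.norm (h * (φ ^ m) g * h⁻¹) = conjLength ((φ ^ m) g) := fun m =>
    Nat.sInf_mem (Set.range_nonempty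
      (fun h : FreeGroup (Fin n) => FreeGroup.norm (h * (φ ^ m) g * h⁻¹)))
  choose c hc using hex
  have key : ∀ a b : ℕ, a < b →
      c a * (φ ^ a) g * (c a)⁻¹ ≠ c b * (φ ^ b) g * (c b)⁻¹ := by
    intro a b hab heq
    have h1 : IsConj ((φ ^ a) g) (c a * (φ ^ a) g * (c a)⁻¹) := isConj_iff.2 ⟨c a, rfl⟩
    have h2 : IsConj ((φ ^ b) g) (c b * (φ ^ b) g * (c b)⁻¹) := isConj_iff.2 ⟨c b, rfl⟩
    rw [← heq] at h2
    have h3 := h2.trans h1.symm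
    refine hat ((φ ^ a) g) ?_ (b - a) (by omega) ?_
    · intro h
      exact hg ((map_eq_one_iff (φ ^ a) (φ ^ a).injective).1 h)
    · rw [← MulAut.mul_apply, ← pow_add, Nat.sub_add_cancel hab.le]
      exact h3
  have hinj : Function.Injective (fun m : ℕ => c m * (φ ^ m) g * (c m)⁻¹) := by
    intro a b hab
    rcases lt_trichotomy a b with h | h | h
    · exact absurd hab (key a b h)
    · exact h
    · exact absurd hab.symm (key b a h)
  rw [Filter.tendsto_atTop]
  intro B
  rw [← Nat.cofinite_eq_atTop, Filter.eventually_cofinite]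
  have hfin : {x : FreeGroup (Fin n) | FreeGroup.norm x ≤ B}.Finite :=
    (List.finite_length_le (Fin n × Bool) B).preimage FreeGroup.toWord_injective.injOn
  refine (hfin.preimage hinj.injOn).subset ?_
  intro m hm
  simp only [Set.mem_preimage, Set.mem_setOf_eq] at hm ⊢
  rw [hc]
  omega
end

section
/- Let φ : F → F be an atoroidal automorphism of a finitely generated free group F. Then for all real numbers L, L' > 0 there exists a positive integer N such that for every nontrivial g ∈ F with conjugacy length ‖g‖ ≤ L and every n ≥ N, one has ‖φ^n(g)‖ ≥ L'. -/
theorem conjLength_aux_finite (n R : ℕ) : {g : FreeGroup (Fin n) | g.norm ≤ R}.Finite :=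
  Set.Finite.preimage (f := FreeGroup.toWord) (FreeGroup.toWord_injective.injOn)
    (List.finite_length_le (Fin n × Bool) R)

theorem conjLength_aux_exists {n : ℕ} (g : FreeGroup (Fin n)) :
    ∃ a : FreeGroup (Fin n), IsConj g a ∧ a.norm = conjLength g := by
  obtain ⟨h, hh⟩ := Nat.sInf_mem
    (Set.range_nonempty fun h : FreeGroup (Fin n) => FreeGroup.norm (h * g * h⁻¹))
  exact ⟨h * g * h⁻¹, isConj_iff.2 ⟨h, rfl⟩, hh⟩

theorem conjLength_aux_lt {n : ℕ} (φ : MulAut (FreeGroup (Fin n)))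
    (hat : ∀ g : FreeGroup (Fin n), g ≠ 1 → ∀ k : ℕ, 0 < k → ¬ IsConj ((φ ^ k) g) g)
    {a b : FreeGroup (Fin n)} (ha : a ≠ 1) {i j : ℕ}
    (hi : IsConj ((φ ^ i) a) b) (hj : IsConj ((φ ^ j) a) b) : ¬ i < j := by
  intro hij
  refine hat ((φ ^ i) a) (by simpa using ha) (j - i) (by omega) ?_
  rw [← MulAut.mul_apply, ← pow_add, Nat.sub_add_cancel hij.le]
  exact hj.trans hi.symm

/-- For an atoroidal automorphism `φ` of a finitely generated free group: for all
`L, L' > 0` there is a positive integer `N` such that every nontrivial `g` with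
conjugacy length at most `L` satisfies `‖φ^m(g)‖ ≥ L'` for all `m ≥ N`. -/
theorem conjLength_uniform_growth (n : ℕ) (φ : MulAut (FreeGroup (Fin n)))
    (hat : ∀ g : FreeGroup (Fin n), g ≠ 1 → ∀ k : ℕ, 0 < k → ¬ IsConj ((φ ^ k) g) g) :
    ∀ L L' : ℝ, 0 < L → 0 < L' → ∃ N : ℕ, 0 < N ∧
      ∀ g : FreeGroup (Fin n), g ≠ 1 → (conjLength g : ℝ) ≤ L →
        ∀ m : ℕ, N ≤ m → L' ≤ (conjLength ((φ ^ m) g) : ℝ) := by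
  intro L L' _ _
  have hfin : (⋃ a ∈ {g : FreeGroup (Fin n) | g.norm ≤ ⌊L⌋₊},
      ⋃ b ∈ {g : FreeGroup (Fin n) | g.norm ≤ ⌊L'⌋₊},
        {m : ℕ | a ≠ 1 ∧ IsConj ((φ ^ m) a) b}).Finite := by
    refine (conjLength_aux_finite n _).biUnion fun a _ =>
      (conjLength_aux_finite n _).biUnion fun b _ => Set.Subsingleton.finite ?_
    rintro i ⟨ha, hi⟩ j ⟨_, hj⟩
    have h1 := conjLength_aux_lt φ hat ha hi hj
    have h2 := conjLength_aux_lt φ hat ha hj hi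
    omega
  obtain ⟨M, hM⟩ := hfin.bddAbove
  refine ⟨M + 1, M.succ_pos, fun g hg hgL m hm => ?_⟩
  by_contra! hlt
  obtain ⟨a, hga, ha⟩ := conjLength_aux_exists g
  obtain ⟨b, hgb, hb⟩ := conjLength_aux_exists ((φ ^ m) g)
  have hmem := hM (a := m) (by
    simp only [Set.mem_iUnion, Set.mem_ofPred_eq]
    refine ⟨a, ha ▸ Nat.le_floor hgL, b, hb ▸ Nat.le_floor hlt.le, ?_, ?_⟩
    · rintro rfl
      exact hg (isConj_one_left.1 hga)
    · exact (MonoidHom.map_isConj (φ ^ m).toMonoidHom hga.symm).trans hgb)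
  omega
end
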